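/- arXiv:2301.11089 — 2 statements merged into one kernel-verified Lean document; each statement's English description precedes it below -/
import Mathlib

section
/- Let J be a real n×n matrix all of whose eigenvalues (over ℂ) have strictly negative real part, and let ξ < 0 be a real number. Then there exists a symmetric positive-definite real n×n matrix Φ such that Jᵀ Φ + Φ J = ξ I. -/
open Matrix

open Filter Topology

/-- In a complex Banach algebra, the powers of an element of spectral radius less than one
tend to zero. -/
theorem tendsto_pow_atTop_nhds_zero_of_spectralRadius_lt_one {A : Type*} [NormedRing A]
    [NormedAlgebra ℂ A] [CompleteSpace A] {a : A} (ha : spectralRadius ℂ a < 1) :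
    Tendsto (fun k : ℕ => a ^ k) atTop (𝓝 0) := by
  obtain ⟨r, hr, hr1⟩ := ENNReal.lt_iff_exists_nnreal_btwn.1 ha
  have hr1 : r < 1 := by exact_mod_cast hr1
  have hev :=
    (spectrum.pow_nnnorm_pow_one_div_tendsto_nhds_spectralRadius a).eventually_lt_const hr
  refine squeeze_zero_norm' ?_
    (tendsto_pow_atTop_nhds_zero_of_lt_one r.coe_nonneg (by exact_mod_cast hr1))
  filter_upwards [hev, eventually_gt_atTop 0] with k hk hk0
  have hle := ENNReal.rpow_le_rpow hk.le (Nat.cast_nonneg (α := ℝ) k)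
  rw [← ENNReal.rpow_mul, one_div, inv_mul_cancel₀ (by positivity), ENNReal.rpow_one,
    ENNReal.rpow_natCast] at hle
  exact_mod_cast hle

namespace Matrix

variable {m : Type*} [Fintype m] [DecidableEq m]

section
attribute [local instance] Matrix.linftyOpNormedRing Matrix.linftyOpNormedAlgebra

/-- The powers of a complex matrix whose eigenvalues lie in the open unit disc tend to zero. -/
theorem tendsto_pow_of_forall_mem_spectrum_norm_lt_one {B : Matrix m m ℂ}
    (hB : ∀ μ ∈ spectrum ℂ B, ‖μ‖ < 1) :
    Tendsto (fun k : ℕ => B ^ k) atTop (𝓝 0) := by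
  rcases isEmpty_or_nonempty m with hm | hm
  · exact tendsto_const_nhds.congr fun k => Subsingleton.elim _ _
  · have : CompleteSpace (Matrix m m ℂ) := FiniteDimensional.complete ℂ _
    exact tendsto_pow_atTop_nhds_zero_of_spectralRadius_lt_one <|
      spectrum.spectralRadius_lt_of_forall_lt B (r := 1) fun z hz => by exact_mod_cast hB z hz

end

/-- The powers of a real matrix whose complex eigenvalues lie in the open unit disc tend to
zero. -/
theorem tendsto_pow_of_forall_mem_spectrum_map_norm_lt_one {A : Matrix m m ℝ}
    (hA : ∀ μ ∈ spectrum ℂ (A.map Complex.ofReal), ‖μ‖ < 1) :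
    Tendsto (fun k : ℕ => A ^ k) atTop (𝓝 0) := by
  have hre : Continuous fun M : Matrix m m ℂ => M.map Complex.re :=
    continuous_id.matrix_map Complex.continuous_re
  have := (hre.tendsto 0).comp (tendsto_pow_of_forall_mem_spectrum_norm_lt_one hA)
  have h0 : (0 : Matrix m m ℂ).map Complex.re = 0 := by ext; simp
  rw [h0] at this
  refine this.congr fun k => ?_
  have hpow : (A ^ k).map Complex.ofReal = A.map Complex.ofReal ^ k :=
    map_pow Complex.ofRealHom.mapMatrix A k
  ext i j
  simp [← hpow]

/-- The Cayley transform maps matrices with spectrum in the open left half-plane to matrices with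
spectrum in the open unit disc. -/
theorem norm_lt_one_of_mem_spectrum_cayley {K D : Matrix m m ℂ}
    (hK : ∀ μ ∈ spectrum ℂ K, μ.re < 0) (hD : (1 - K) * D = 1) {μ : ℂ}
    (hμ : μ ∈ spectrum ℂ ((1 + K) * D)) : ‖μ‖ < 1 := by
  have hDu : IsUnit D := IsUnit.of_mul_eq_one (1 - K) (mul_eq_one_comm.1 hD)
  have hfac : algebraMap ℂ (Matrix m m ℂ) μ - (1 + K) * D
      = ((μ - 1) • 1 - (μ + 1) • K) * D := by
    calc algebraMap ℂ (Matrix m m ℂ) μ - (1 + K) * D = μ • ((1 - K) * D) - (1 + K) * D := by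
          rw [hD, Algebra.algebraMap_eq_smul_one]
      _ = _ := by
          simp only [sub_mul, add_mul, sub_smul, add_smul, smul_sub, one_smul, smul_mul_assoc]
          abel
  rw [spectrum.mem_iff, hfac] at hμ
  have hμ1 : μ + 1 ≠ 0 := by
    intro h
    refine hμ (IsUnit.mul ?_ hDu)
    rw [h, zero_smul, sub_zero, eq_neg_of_add_eq_zero_left h]
    exact (isUnit_one (M := Matrix m m ℂ)).smul (Units.mk0 (-1 - 1 : ℂ) (by norm_num))
  have hmem : (μ - 1) / (μ + 1) ∈ spectrum ℂ K := by
    rw [spectrum.mem_iff]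
    intro h
    refine hμ (IsUnit.mul ?_ hDu)
    convert! h.smul (Units.mk0 _ hμ1) using 1
    rw [Units.smul_mk0, smul_sub, Algebra.algebraMap_eq_smul_one, smul_smul, mul_div_cancel₀ _ hμ1]
  have hre := hK _ hmem
  have hpos : 0 < Complex.normSq (μ + 1) := Complex.normSq_pos.2 hμ1
  rw [Complex.div_re, ← add_div, div_lt_iff₀ hpos, zero_mul] at hre
  rw [← sq_lt_one_iff₀ (norm_nonneg _), Complex.sq_norm, Complex.normSq_apply]
  simp at hre
  nlinarith

/-- The Cayley transform turns the Lyapunov operator into the Stein operator. -/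
theorem cayley_transpose_mul_mul {J C : Matrix m m ℝ} (hC : (1 - J) * C = 1) (Φ : Matrix m m ℝ) :
    ((1 + J) * C)ᵀ * Φ * ((1 + J) * C) = Φ + (2 : ℝ) • (Cᵀ * (Jᵀ * Φ + Φ * J) * C) := by
  have hCt : Cᵀ * (1 - Jᵀ) = 1 := by
    simpa using congrArg transpose hC
  have key : (1 + Jᵀ) * Φ * (1 + J) = (1 - Jᵀ) * Φ * (1 - J) + (2 : ℝ) • (Jᵀ * Φ + Φ * J) := by
    rw [two_smul]
    noncomm_ring
  calc ((1 + J) * C)ᵀ * Φ * ((1 + J) * C) = Cᵀ * ((1 + Jᵀ) * Φ * (1 + J)) * C := by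
        simp only [transpose_mul, transpose_add, transpose_one, Matrix.mul_assoc]
    _ = (Cᵀ * (1 - Jᵀ)) * Φ * ((1 - J) * C) + (2 : ℝ) • (Cᵀ * (Jᵀ * Φ + Φ * J) * C) := by
        rw [key]
        simp only [Matrix.mul_add, Matrix.add_mul, Matrix.mul_smul, Matrix.smul_mul,
          Matrix.mul_assoc]
    _ = _ := by rw [hCt, hC, Matrix.one_mul, Matrix.mul_one]

/-- A fixed point of `X ↦ Aᵀ X A` vanishes when the powers of `A` tend to zero. -/
theorem eq_zero_of_transpose_mul_mul_eq_self {A Φ : Matrix m m ℝ}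
    (hA : Tendsto (fun k : ℕ => A ^ k) atTop (𝓝 0)) (h : Aᵀ * Φ * A = Φ) : Φ = 0 := by
  have hpow : ∀ k : ℕ, (A ^ k)ᵀ * Φ * A ^ k = Φ := by
    intro k
    induction k with
    | zero => simp
    | succ k ih =>
      calc (A ^ (k + 1))ᵀ * Φ * A ^ (k + 1) = (A ^ k)ᵀ * (Aᵀ * Φ * A) * A ^ k := by
            conv_lhs => rw [pow_succ' A k]
            simp only [transpose_mul, Matrix.mul_assoc]
        _ = Φ := by rw [h, ih]
  have hcont : Continuous fun M : Matrix m m ℝ => Mᵀ * Φ * M := by fun_prop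
  have hlim := (hcont.tendsto 0).comp hA
  simp only [Function.comp_def, hpow, Matrix.mul_zero] at hlim
  exact tendsto_nhds_unique tendsto_const_nhds hlim

/-- A solution of a Stein inequality is positive definite when the powers of `A` tend to zero. -/
theorem posDef_of_forall_dotProduct_mulVec_lt {A Φ : Matrix m m ℝ} (hΦ : Φᵀ = Φ)
    (hA : Tendsto (fun k : ℕ => A ^ k) atTop (𝓝 0))
    (h : ∀ x ≠ 0, (A *ᵥ x) ⬝ᵥ (Φ *ᵥ (A *ᵥ x)) < x ⬝ᵥ (Φ *ᵥ x)) : Φ.PosDef := by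
  refine .of_dotProduct_mulVec_pos (by simpa [IsHermitian] using hΦ) fun x hx => ?_
  set V : (m → ℝ) → ℝ := fun y => y ⬝ᵥ (Φ *ᵥ y) with hV
  have hle : ∀ y, V (A *ᵥ y) ≤ V y := by
    intro y
    rcases eq_or_ne y 0 with rfl | hy
    · simp
    · exact (h y hy).le
  have hanti : Antitone fun k : ℕ => V (A ^ k *ᵥ x) := antitone_nat_of_succ_le fun k => by
    simpa [pow_succ', mulVec_mulVec] using hle (A ^ k *ᵥ x)
  have hcont : Continuous fun M : Matrix m m ℝ => V (M *ᵥ x) := by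
    simp only [hV]
    fun_prop
  have hlim : Tendsto (fun k : ℕ => V (A ^ k *ᵥ x)) atTop (𝓝 0) := by
    simpa [Function.comp_def, hV] using (hcont.tendsto 0).comp hA
  have h1 : 0 ≤ V (A *ᵥ x) := by simpa using hanti.le_of_tendsto hlim 1
  simpa using h1.trans_lt (h x hx)

end Matrix

/-- **Lyapunov stability criterion (existence direction).**
If every eigenvalue of the real matrix `J` (over `ℂ`) has strictly negative real part
and `ξ < 0`, then there exists a symmetric positive-definite real matrix `Φ` with
`Jᵀ Φ + Φ J = ξ • I`. -/
theorem hurwitz_implies_lyapunov_posDef_solution {n : ℕ}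
    (J : Matrix (Fin n) (Fin n) ℝ) (ξ : ℝ) (hξ : ξ < 0)
    (hJ : ∀ μ ∈ spectrum ℂ (J.map (Complex.ofReal)), μ.re < 0) :
    ∃ Φ : Matrix (Fin n) (Fin n) ℝ, Φᵀ = Φ ∧ Φ.PosDef ∧
      Jᵀ * Φ + Φ * J = ξ • (1 : Matrix (Fin n) (Fin n) ℝ) := by
  set K : Matrix (Fin n) (Fin n) ℂ := J.map Complex.ofReal
  have hsub : 1 - K = Complex.ofRealHom.mapMatrix (1 - J) := by
    rw [map_sub, map_one]
    rfl
  have hadd : 1 + K = Complex.ofRealHom.mapMatrix (1 + J) := by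
    rw [map_add, map_one]
    rfl
  have hdet : IsUnit (1 - J).det := by
    rw [isUnit_iff_ne_zero]
    intro h0
    have h1 : (1 : ℂ) ∈ spectrum ℂ K := by
      rw [spectrum.mem_iff, map_one, Matrix.isUnit_iff_isUnit_det, hsub, ← RingHom.map_det, h0]
      simp
    have := hJ 1 h1
    norm_num at this
  set C : Matrix (Fin n) (Fin n) ℝ := (1 - J)⁻¹
  have hC : (1 - J) * C = 1 := Matrix.mul_nonsing_inv _ hdet
  have hCinj : ∀ x, C *ᵥ x = 0 → x = 0 := fun x hx => by
    rw [← Matrix.one_mulVec x, ← hC, ← Matrix.mulVec_mulVec, hx, Matrix.mulVec_zero]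
  have hA : Tendsto (fun k : ℕ => ((1 + J) * C) ^ k) atTop (𝓝 0) := by
    refine Matrix.tendsto_pow_of_forall_mem_spectrum_map_norm_lt_one fun μ hμ => ?_
    have hD : (1 - K) * Complex.ofRealHom.mapMatrix C = 1 := by
      rw [hsub, ← map_mul, hC, map_one]
    have hmap : ((1 + J) * C).map Complex.ofReal = (1 + K) * Complex.ofRealHom.mapMatrix C := by
      rw [hadd, ← map_mul]
      rfl
    exact Matrix.norm_lt_one_of_mem_spectrum_cayley hJ hD (hmap ▸ hμ)
  let L : Matrix (Fin n) (Fin n) ℝ →ₗ[ℝ] Matrix (Fin n) (Fin n) ℝ :=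
    LinearMap.mulLeft ℝ Jᵀ + LinearMap.mulRight ℝ J
  have hinj : Function.Injective L := by
    refine (injective_iff_map_eq_zero L).2 fun Φ hΦ => ?_
    have hΦ : Jᵀ * Φ + Φ * J = 0 := hΦ
    exact Matrix.eq_zero_of_transpose_mul_mul_eq_self hA (by
      rw [Matrix.cayley_transpose_mul_mul hC, hΦ]
      simp)
  obtain ⟨Φ, hΦ⟩ := LinearMap.surjective_of_injective hinj (ξ • 1)
  have hΦ : Jᵀ * Φ + Φ * J = ξ • (1 : Matrix (Fin n) (Fin n) ℝ) := hΦ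
  have hsymm : Φᵀ = Φ := by
    refine hinj (?_ : Jᵀ * Φᵀ + Φᵀ * J = Jᵀ * Φ + Φ * J)
    rw [hΦ]
    simpa [add_comm] using congrArg transpose hΦ
  refine ⟨Φ, hsymm, Matrix.posDef_of_forall_dotProduct_mulVec_lt hsymm hA fun x hx => ?_, hΦ⟩
  have hpos : 0 < (C *ᵥ x) ⬝ᵥ (C *ᵥ x) := by
    simpa using Matrix.dotProduct_star_self_pos_iff.2 (mt (hCinj x) hx)
  have hquad : ∀ M N : Matrix (Fin n) (Fin n) ℝ,
      (N *ᵥ x) ⬝ᵥ (M *ᵥ (N *ᵥ x)) = x ⬝ᵥ ((Nᵀ * M * N) *ᵥ x) := fun M N => by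
    rw [← Matrix.mulVec_mulVec, ← Matrix.mulVec_mulVec, Matrix.dotProduct_mulVec x,
      Matrix.vecMul_transpose]
  have hstein : (((1 + J) * C) *ᵥ x) ⬝ᵥ (Φ *ᵥ (((1 + J) * C) *ᵥ x))
      = x ⬝ᵥ (Φ *ᵥ x) + 2 * (ξ * ((C *ᵥ x) ⬝ᵥ (C *ᵥ x))) := by
    rw [hquad, Matrix.cayley_transpose_mul_mul hC, Matrix.add_mulVec, dotProduct_add,
      Matrix.smul_mulVec, dotProduct_smul, hΦ, ← hquad, Matrix.smul_mulVec, Matrix.one_mulVec,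
      dotProduct_smul, smul_eq_mul, smul_eq_mul]
  rw [hstein]
  linarith [mul_neg_of_neg_of_pos hξ hpos]
end

section
/- Let J be a real n×n matrix, Φ a real symmetric n×n matrix, and η ≤ 0 a real number such that −JᵀΦ − ΦJ + ηI is positive semidefinite and I − Φ is positive semidefinite. Let x : ℝ → ℝⁿ be differentiable with x′(t) = J x(t) for all t, and set L(t) = x(t)ᵀ Φ x(t). Then for all t, L′(t) ≤ η · x(t)ᵀx(t) ≤ η · L(t). -/
open Matrix

theorem HasDerivAt.dotProduct_real {ι : Type*} [Fintype ι] {f g : ℝ → ι → ℝ} {f' g' : ι → ℝ}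
    {t : ℝ} (hf : HasDerivAt f f' t) (hg : HasDerivAt g g' t) :
    HasDerivAt (fun s => f s ⬝ᵥ g s) (f' ⬝ᵥ g t + f t ⬝ᵥ g') t := by
  rw [hasDerivAt_pi] at hf hg
  simp only [dotProduct, ← Finset.sum_add_distrib]
  exact HasDerivAt.fun_sum fun i _ => (hf i).mul (hg i)

theorem HasDerivAt.const_mulVec_real {ι κ : Type*} [Fintype ι] [Fintype κ] (A : Matrix κ ι ℝ)
    {f : ℝ → ι → ℝ} {f' : ι → ℝ} {t : ℝ} (hf : HasDerivAt f f' t) :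
    HasDerivAt (fun s => A *ᵥ f s) (A *ᵥ f') t :=
  (LinearMap.toContinuousLinearMap A.mulVecLin).hasFDerivAt.comp_hasDerivAt t hf

/-- **The Lyapunov-function decay inequality (5) of the paper.**
If `η ≤ 0`, `−JᵀΦ − ΦJ + ηI ⪰ 0` and `I − Φ ⪰ 0` with `Φ` symmetric, then along any
trajectory `x` of `ẋ = Jx`, the Lyapunov function `L(t) = x(t)ᵀ Φ x(t)` satisfies
`L′(t) ≤ η · x(t)ᵀx(t) ≤ η · L(t)` for all `t`. -/
theorem lyapunov_function_decay {n : ℕ}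
    (J Φ : Matrix (Fin n) (Fin n) ℝ) (η : ℝ) (hη : η ≤ 0) (hΦsym : Φᵀ = Φ)
    (h1 : (-(Jᵀ * Φ) - Φ * J + η • (1 : Matrix (Fin n) (Fin n) ℝ)).PosSemidef)
    (h2 : ((1 : Matrix (Fin n) (Fin n) ℝ) - Φ).PosSemidef)
    (x : ℝ → Fin n → ℝ)
    (hx : ∀ t : ℝ, HasDerivAt x (J.mulVec (x t)) t) :
    ∀ (t L' : ℝ), HasDerivAt (fun s => x s ⬝ᵥ Φ.mulVec (x s)) L' t →
      L' ≤ η * (x t ⬝ᵥ x t) ∧ η * (x t ⬝ᵥ x t) ≤ η * (x t ⬝ᵥ Φ.mulVec (x t)) := by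
  intro t L' hL
  have hL' : L' = J *ᵥ x t ⬝ᵥ Φ *ᵥ x t + x t ⬝ᵥ Φ *ᵥ (J *ᵥ x t) :=
    hL.unique ((hx t).dotProduct_real ((hx t).const_mulVec_real Φ))
  have hJ := h1.dotProduct_mulVec_nonneg (x t)
  have hΦ := h2.dotProduct_mulVec_nonneg (x t)
  have hadj : x t ⬝ᵥ Jᵀ *ᵥ (Φ *ᵥ x t) = J *ᵥ x t ⬝ᵥ Φ *ᵥ x t := by
    rw [dotProduct_mulVec, vecMul_transpose]
  simp only [star_trivial, add_mulVec, sub_mulVec, neg_mulVec, smul_mulVec, one_mulVec,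
    dotProduct_add, dotProduct_sub, dotProduct_neg, dotProduct_smul, smul_eq_mul,
    ← mulVec_mulVec, hadj] at hJ hΦ
  exact ⟨by linarith, mul_le_mul_of_nonpos_left (by linarith) hη⟩
end
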